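/- arXiv:2306.15004 — 3 statements merged into one kernel-verified Lean document; each statement's English description precedes it below -/
import Mathlib

section
/- Consider a tensor factor graph as in the context, with all tensor entries T_i(x_i, r_{∂i}) and all environment entries E_{b→i}(v) strictly positive (so all local partition functions are positive, all local marginals are well defined and strictly positive, and Σ_{x_i,r_{∂i}} m_i(x_i,r_{∂i}) = 1 and Σ_v m_b(v) = 1). Assume the marginal-consistency condition: for every node i, every incident bond b ∈ ∂i, and every v ∈ D_b, the sum of m_i(x_i, r_{∂i}) over all x_i and all r_{∂i} with r_b = v equals m_b(v). Then the Bethe free entropy satisfies the identity: − Σ_{i∈V} Σ_{x_i, r_{∂i}} m_i(x_i, r_{∂i}) · log( m_i(x_i, r_{∂i}) / T_i(x_i, r_{∂i}) ) + Σ_{b∈B} Σ_{v∈D_b} m_b(v) · log m_b(v) = Σ_{i∈V} log Z_{∂i} − Σ_{b∈B} log Z_b. That is, the Bethe free entropy expressed in terms of local marginals equals the sum over nodes of the logarithms of the local partition functions minus the sum over bonds of the logarithms of the bond partition functions. -/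
/-!
STATEMENT 3: For a tensor factor graph (nodes `i : V` with tensors `T i`, bonds `b : B`
with two distinct endpoints `ep0 b ≠ ep1 b`, index sets `D b`, physical alphabets `X i`,
and environments `E0 b = E_{b→ep0 b}`, `E1 b = E_{b→ep1 b}`), with all tensor and
environment entries strictly positive, and assuming the marginal-consistency condition
(for every node `i`, incident bond `b ∈ ∂i` and value `v`, summing the node marginal
`m_i` over all configurations with `r_b = v` gives the bond marginal `m_b(v)`),
the Bethe free entropy expressed in terms of local marginals equals
`∑ i, log Z_{∂i} − ∑ b, log Z_b`:
`− ∑_i ∑ m_i log(m_i / T_i) + ∑_b ∑ m_b log m_b = ∑_i log Z_{∂i} − ∑_b log Z_b`.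
The incident-bond set of node `i` is `∂i = {b // ep0 b = i ∨ ep1 b = i}`.
-/

theorem tensor_factor_graph_bethe_free_entropy
    (V B : Type) [Fintype V] [Fintype B] [DecidableEq V] [DecidableEq B]
    (D : B → Type) [∀ b, Fintype (D b)] [∀ b, Nonempty (D b)] [∀ b, DecidableEq (D b)]
    (X : V → Type) [∀ i, Fintype (X i)] [∀ i, Nonempty (X i)]
    (ep0 ep1 : B → V) (hep : ∀ b, ep0 b ≠ ep1 b)
    (T : ∀ i : V, X i → (∀ b : {b : B // ep0 b = i ∨ ep1 b = i}, D b.1) → ℝ)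
    (E0 E1 : ∀ b : B, D b → ℝ)
    (hT : ∀ i x s, 0 < T i x s)
    (hE0 : ∀ b v, 0 < E0 b v) (hE1 : ∀ b v, 0 < E1 b v)
    -- local node partition functions Z_{∂i}
    (Znode : V → ℝ)
    (hZnode : ∀ i : V, Znode i =
      ∑ x : X i, ∑ s : (∀ b : {b : B // ep0 b = i ∨ ep1 b = i}, D b.1),
        T i x s * ∏ b : {b : B // ep0 b = i ∨ ep1 b = i},
          (if ep0 b.1 = i then E0 b.1 (s b) else E1 b.1 (s b)))
    -- local bond partition functions Z_b
    (Zbond : B → ℝ)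
    (hZbond : ∀ b : B, Zbond b = ∑ v : D b, E0 b v * E1 b v)
    -- node marginals m_i
    (mnode : ∀ i : V, X i → (∀ b : {b : B // ep0 b = i ∨ ep1 b = i}, D b.1) → ℝ)
    (hmnode : ∀ i x s, mnode i x s =
      (T i x s * ∏ b : {b : B // ep0 b = i ∨ ep1 b = i},
        (if ep0 b.1 = i then E0 b.1 (s b) else E1 b.1 (s b))) / Znode i)
    -- bond marginals m_b
    (mbond : ∀ b : B, D b → ℝ)
    (hmbond : ∀ b v, mbond b v = E0 b v * E1 b v / Zbond b)
    -- marginal-consistency condition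
    (hcons : ∀ (i : V) (b : {b : B // ep0 b = i ∨ ep1 b = i}) (v : D b.1),
      (∑ x : X i, ∑ s : (∀ c : {c : B // ep0 c = i ∨ ep1 c = i}, D c.1),
        (if s b = v then mnode i x s else 0)) = mbond b.1 v) :
    (- ∑ i : V, ∑ x : X i, ∑ s : (∀ b : {b : B // ep0 b = i ∨ ep1 b = i}, D b.1),
        mnode i x s * Real.log (mnode i x s / T i x s))
    + (∑ b : B, ∑ v : D b, mbond b v * Real.log (mbond b v))
    = (∑ i : V, Real.log (Znode i)) - (∑ b : B, Real.log (Zbond b)) := by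
  have hP : ∀ i (s : ∀ b : {b : B // ep0 b = i ∨ ep1 b = i}, D b.1)
      (b : {b : B // ep0 b = i ∨ ep1 b = i}),
      0 < (if ep0 b.1 = i then E0 b.1 (s b) else E1 b.1 (s b)) := by
    intro i s b
    split_ifs
    · exact hE0 _ _
    · exact hE1 _ _
  have hZn : ∀ i, 0 < Znode i := by
    intro i
    rw [hZnode]
    refine Finset.sum_pos (fun x _ => Finset.sum_pos (fun s _ => ?_) Finset.univ_nonempty)
      Finset.univ_nonempty
    exact mul_pos (hT _ _ _) (Finset.prod_pos fun b _ => hP i s b)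
  have hZb : ∀ b, 0 < Zbond b := by
    intro b
    rw [hZbond]
    exact Finset.sum_pos (fun v _ => mul_pos (hE0 _ _) (hE1 _ _)) Finset.univ_nonempty
  have hsn : ∀ i, ∑ x, ∑ s, mnode i x s = 1 := by
    intro i
    simp_rw [hmnode, ← Finset.sum_div]
    rw [← hZnode]
    exact div_self (hZn i).ne'
  have hsb : ∀ b, ∑ v : D b, mbond b v = 1 := by
    intro b
    simp_rw [hmbond, ← Finset.sum_div]
    rw [← hZbond]
    exact div_self (hZb b).ne'
  have key : ∀ (i : V) (b : {b : B // ep0 b = i ∨ ep1 b = i}) (f : D b.1 → ℝ),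
      ∑ x, ∑ s, mnode i x s * f (s b) = ∑ v : D b.1, mbond b.1 v * f v := by
    intro i b f
    simp_rw [← hcons i b, Finset.sum_mul]
    symm
    rw [Finset.sum_comm]
    refine Finset.sum_congr rfl fun x _ => ?_
    rw [Finset.sum_comm]
    refine Finset.sum_congr rfl fun s _ => ?_
    simp [ite_mul]
  have hnode : ∀ i, ∑ x, ∑ s, mnode i x s * Real.log (mnode i x s / T i x s)
      = (∑ b : {b : B // ep0 b = i ∨ ep1 b = i}, ∑ v : D b.1, mbond b.1 v *
          (if ep0 b.1 = i then Real.log (E0 b.1 v) else Real.log (E1 b.1 v)))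
        - Real.log (Znode i) := by
    intro i
    have h1 : ∀ x s, mnode i x s * Real.log (mnode i x s / T i x s)
        = (∑ b : {b : B // ep0 b = i ∨ ep1 b = i}, mnode i x s *
          (if ep0 b.1 = i then Real.log (E0 b.1 (s b)) else Real.log (E1 b.1 (s b))))
          - mnode i x s * Real.log (Znode i) := by
      intro x s
      rw [← Finset.mul_sum, ← mul_sub]
      congr 1
      have h2 : mnode i x s / T i x s = (∏ b : {b : B // ep0 b = i ∨ ep1 b = i},
          (if ep0 b.1 = i then E0 b.1 (s b) else E1 b.1 (s b))) / Znode i := by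
        rw [hmnode]
        have := (hT i x s).ne'
        have := (hZn i).ne'
        field_simp
      rw [h2, Real.log_div (Finset.prod_pos fun b _ => hP i s b).ne' (hZn i).ne',
        Real.log_prod (fun b _ => (hP i s b).ne')]
      congr 1
      refine Finset.sum_congr rfl fun b _ => ?_
      split_ifs <;> rfl
    simp_rw [h1, Finset.sum_sub_distrib, ← Finset.sum_mul]
    rw [hsn, one_mul]
    congr 1
    rw [Finset.sum_congr rfl fun x _ => Finset.sum_comm, Finset.sum_comm]
    refine Finset.sum_congr rfl fun b _ => ?_
    exact key i b (fun v => if ep0 b.1 = i then Real.log (E0 b.1 v) else Real.log (E1 b.1 v))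
  have hbond : ∀ b, ∑ v : D b, mbond b v * Real.log (mbond b v)
      = (∑ v : D b, mbond b v * Real.log (E0 b v)) + (∑ v : D b, mbond b v * Real.log (E1 b v))
        - Real.log (Zbond b) := by
    intro b
    have h1 : ∀ v, mbond b v * Real.log (mbond b v) = mbond b v * Real.log (E0 b v)
        + mbond b v * Real.log (E1 b v) - mbond b v * Real.log (Zbond b) := by
      intro v
      have : Real.log (mbond b v)
          = Real.log (E0 b v) + Real.log (E1 b v) - Real.log (Zbond b) := by
        rw [hmbond, Real.log_div (mul_pos (hE0 b v) (hE1 b v)).ne' (hZb b).ne',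
          Real.log_mul (hE0 b v).ne' (hE1 b v).ne']
      rw [this]
      ring
    simp_rw [h1, Finset.sum_sub_distrib, Finset.sum_add_distrib, ← Finset.sum_mul]
    rw [hsb, one_mul]
  have hswap : ∑ i, ∑ b : {b : B // ep0 b = i ∨ ep1 b = i}, ∑ v : D b.1, mbond b.1 v *
          (if ep0 b.1 = i then Real.log (E0 b.1 v) else Real.log (E1 b.1 v))
      = ∑ b, ((∑ v : D b, mbond b v * Real.log (E0 b v)) + ∑ v : D b, mbond b v * Real.log (E1 b v)) := by
    have h1 : ∀ i, ∑ b : {b : B // ep0 b = i ∨ ep1 b = i}, ∑ v : D b.1, mbond b.1 v *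
          (if ep0 b.1 = i then Real.log (E0 b.1 v) else Real.log (E1 b.1 v))
        = ∑ b, ((if ep0 b = i then ∑ v : D b, mbond b v * Real.log (E0 b v) else 0)
          + (if ep1 b = i then ∑ v : D b, mbond b v * Real.log (E1 b v) else 0)) := by
      intro i
      rw [← Finset.sum_subtype (Finset.univ.filter fun b => ep0 b = i ∨ ep1 b = i)
        (by simp) (fun b => ∑ v : D b, mbond b v *
          (if ep0 b = i then Real.log (E0 b v) else Real.log (E1 b v))), Finset.sum_filter]
      refine Finset.sum_congr rfl fun b _ => ?_
      by_cases h0 : ep0 b = i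
      · have h3 : ep1 b ≠ i := fun h => hep b (h0.trans h.symm)
        simp [h0, h3]
      · by_cases h3 : ep1 b = i <;> simp [h0, h3]
    simp_rw [h1]
    rw [Finset.sum_comm]
    refine Finset.sum_congr rfl fun b _ => ?_
    simp [Finset.sum_add_distrib]
  simp_rw [hnode, hbond, Finset.sum_sub_distrib]
  rw [hswap]
  ring
end

section
/- Let J be a finite set, and define the Survey Propagation clause tensor 𝒜_{a→j} with one output index out ∈ {1,…,5} and one index r_j ∈ {1,…,5} for each j ∈ J by 𝒜_{a→j}(out, r) = 1[out = 1]·∏_{j∈J} 1[r_j = 3] + 1[out = 2]·( ∏_{j∈J} 1[r_j ∈ {3,4,5}] − ∏_{j∈J} 1[r_j = 3] ). Then for any family of environment vectors E_j : {1,…,5} → ℝ (j ∈ J) satisfying the normalization E_j(3) + E_j(4) + E_j(5) = 1 for every j, the contraction Σ_{r ∈ {1,…,5}^J} 𝒜_{a→j}(out, r) · ∏_{j∈J} E_j(r_j) equals, as a function of out, the vector ( ∏_{j∈J} E_j(3), 1 − ∏_{j∈J} E_j(3), 0, 0, 0 ). In particular, with E_j(3) = Q^U_{j}, the tensor contraction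 reproduces the Survey Propagation clause-to-variable update Q̂ = ∏_{j∈J} Q^U_{j}, and the output is a valid clause-to-variable environment of the form (Q̂, 1−Q̂, 0, 0, 0). -/
/-!
STATEMENT 6: The Survey Propagation clause tensor.  Environments live in `ℝ⁵`, indexed
here by `Fin 5`, where coordinate `k : Fin 5` represents the paper's index `k + 1`
(so paper indices 1,2,3,4,5 are `0,1,2,3,4 : Fin 5`).  The clause tensor is
`𝒜_{a→j}(out, r) = 1[out = 1]·∏_j 1[r_j = 3] + 1[out = 2]·(∏_j 1[r_j ∈ {3,4,5}] − ∏_j 1[r_j = 3])`.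
For any family of environments `E j : Fin 5 → ℝ` normalized by `E j 3 + E j 4 + E j 5 = 1`
(paper indices), the contraction of the clause tensor against the incoming environments
equals the vector `(Q̂, 1 − Q̂, 0, 0, 0)` with `Q̂ = ∏ j, Q^U_j` and `Q^U_j = E j 3`
(paper index 3, i.e. `E j 2` in `Fin 5`): the SP clause-to-variable update.
-/

theorem survey_propagation_clause_tensor_contraction
    (J : Type) [Fintype J] [DecidableEq J]
    (E : J → Fin 5 → ℝ)
    (hE : ∀ j : J, E j 2 + E j 3 + E j 4 = 1) :
    ∀ out : Fin 5,
      (∑ r : J → Fin 5,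
        ((if out = 0 then (1 : ℝ) else 0) * (∏ j : J, (if r j = 2 then (1 : ℝ) else 0))
          + (if out = 1 then (1 : ℝ) else 0) *
            ((∏ j : J, (if r j = 2 ∨ r j = 3 ∨ r j = 4 then (1 : ℝ) else 0))
              - ∏ j : J, (if r j = 2 then (1 : ℝ) else 0)))
        * ∏ j : J, E j (r j))
      = ![∏ j : J, E j 2, 1 - ∏ j : J, E j 2, 0, 0, 0] out := by
  have key : ∀ f : J → Fin 5 → ℝ, ∑ r : J → Fin 5, ∏ j : J, f j (r j) = ∏ j : J, ∑ k : Fin 5, f j k :=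
    fun f => (Fintype.prod_sum f).symm
  have h1 : ∑ r : J → Fin 5, (∏ j : J, (if r j = 2 then (1 : ℝ) else 0)) * ∏ j : J, E j (r j)
      = ∏ j : J, E j 2 := by
    simp_rw [← Finset.prod_mul_distrib]
    rw [key (fun j k => (if k = 2 then (1 : ℝ) else 0) * E j k)]
    refine Finset.prod_congr rfl fun j _ => ?_
    simp
  have h2 : ∑ r : J → Fin 5, (∏ j : J, (if r j = 2 ∨ r j = 3 ∨ r j = 4 then (1 : ℝ) else 0))
      * ∏ j : J, E j (r j) = 1 := by
    simp_rw [← Finset.prod_mul_distrib]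
    rw [key (fun j k => (if k = 2 ∨ k = 3 ∨ k = 4 then (1 : ℝ) else 0) * E j k)]
    refine Finset.prod_eq_one fun j _ => ?_
    rw [Fin.sum_univ_five]
    simpa [Fin.ext_iff] using hE j
  intro out
  simp_rw [add_mul, mul_assoc, sub_mul]
  rw [Finset.sum_add_distrib, ← Finset.mul_sum, ← Finset.mul_sum, Finset.sum_sub_distrib, h1, h2]
  fin_cases out <;> simp
end

section
/- Let S and U be disjoint finite sets (the clauses forcing a variable j in the same direction as a clause a, and in the opposite direction, respectively), and define the Survey Propagation variable tensor 𝒜_{j→a} with one output index out ∈ {1,…,5} and one index r_b ∈ {1,…,5} for each b ∈ S ∪ U by 𝒜_{j→a}(out, r) = 1[out = 3]·(∏_{b∈S} 1[r_b = 2])·( ∏_{b∈U} 1[r_b ∈ {1,2}] − ∏_{b∈U} 1[r_b = 2] ) + 1[out = 4]·(∏_{b∈U} 1[r_b = 2])·( ∏_{b∈S} 1[r_b ∈ {1,2}] − ∏_{b∈S} 1[r_b = 2] ) + 1[out = 5]·(∏_{b∈S} 1[r_b = 2])·(∏_{b∈U} 1[r_b = 2]). Then for any family of environment vectors E_b : {1,…,5}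 → ℝ (b ∈ S ∪ U) satisfying E_b(1) + E_b(2) = 1 for every b, the contraction Σ_{r ∈ {1,…,5}^{S∪U}} 𝒜_{j→a}(out, r) · ∏_{b∈S∪U} E_b(r_b) equals, as a function of out, the vector ( 0, 0, P_S·(1−P_U), P_U·(1−P_S), P_S·P_U ), where P_S = ∏_{b∈S} E_b(2) and P_U = ∏_{b∈U} E_b(2). In particular, with E_b = (Q̂_b, 1−Q̂_b, 0, 0, 0), so that P_S = ∏_{b∈S}(1−Q̂_b) and P_U = ∏_{b∈U}(1−Q̂_b), the tensor contraction reproduces the (unnormalized) Survey Propagation variable-to-clause updates Q^U ∝ P_S(1−P_U), Q^S ∝ P_U(1−P_S), Q^* ∝ P_S·P_U. -/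
/-!
STATEMENT 7: The Survey Propagation variable tensor.  The disjoint finite sets `S` and
`U` of clauses are modeled as two finite types, with index set `S ⊕ U` (disjoint union).
Environments live in `ℝ⁵`, indexed here by `Fin 5`, where coordinate `k : Fin 5`
represents the paper's index `k + 1` (so paper indices 1,2,3,4,5 are `0,1,2,3,4`).
The variable tensor is
`𝒜_{j→a}(out, r) = 1[out=3]·(∏_{b∈S} 1[r_b=2])·(∏_{b∈U} 1[r_b∈{1,2}] − ∏_{b∈U} 1[r_b=2])`
` + 1[out=4]·(∏_{b∈U} 1[r_b=2])·(∏_{b∈S} 1[r_b∈{1,2}] − ∏_{b∈S} 1[r_b=2])`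
` + 1[out=5]·(∏_{b∈S} 1[r_b=2])·(∏_{b∈U} 1[r_b=2])` (paper indices).
For environments `E b : Fin 5 → ℝ` with `E b 1 + E b 2 = 1` (paper indices), the
contraction equals `(0, 0, P_S(1−P_U), P_U(1−P_S), P_S·P_U)` where
`P_S = ∏_{b∈S} E b 2` and `P_U = ∏_{b∈U} E b 2` (paper index 2, i.e. `Fin 5` index 1):
the (unnormalized) SP variable-to-clause update.
-/

theorem sp_factor (S U : Type) [Fintype S] [Fintype U] [DecidableEq S] [DecidableEq U]
    (E : S ⊕ U → Fin 5 → ℝ) (f g : Fin 5 → ℝ) :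
    ∑ r : S ⊕ U → Fin 5, (∏ b : S, f (r (Sum.inl b))) * (∏ b : U, g (r (Sum.inr b)))
      * ∏ b : S ⊕ U, E b (r b)
    = (∏ b : S, ∑ k, f k * E (Sum.inl b) k) * (∏ b : U, ∑ k, g k * E (Sum.inr b) k) := by
  have h := Finset.prod_univ_sum (fun _ : S ⊕ U => (Finset.univ : Finset (Fin 5)))
    (fun b k => (Sum.elim (fun _ => f) (fun _ => g) b : Fin 5 → ℝ) k * E b k)
  rw [Fintype.piFinset_univ] at h
  rw [Fintype.prod_sum_type] at h
  simp only [Sum.elim_inl, Sum.elim_inr] at h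
  rw [h]
  refine Finset.sum_congr rfl fun r _ => ?_
  rw [Fintype.prod_sum_type, Fintype.prod_sum_type]
  simp only [Sum.elim_inl, Sum.elim_inr, Finset.prod_mul_distrib]
  ring

theorem survey_propagation_variable_tensor_contraction
    (S U : Type) [Fintype S] [Fintype U] [DecidableEq S] [DecidableEq U]
    (E : S ⊕ U → Fin 5 → ℝ)
    (hE : ∀ b : S ⊕ U, E b 0 + E b 1 = 1) :
    ∀ out : Fin 5,
      (∑ r : S ⊕ U → Fin 5,
        ((if out = 2 then (1 : ℝ) else 0)
            * (∏ b : S, (if r (Sum.inl b) = 1 then (1 : ℝ) else 0))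
            * ((∏ b : U, (if r (Sum.inr b) = 0 ∨ r (Sum.inr b) = 1 then (1 : ℝ) else 0))
                - ∏ b : U, (if r (Sum.inr b) = 1 then (1 : ℝ) else 0))
          + (if out = 3 then (1 : ℝ) else 0)
            * (∏ b : U, (if r (Sum.inr b) = 1 then (1 : ℝ) else 0))
            * ((∏ b : S, (if r (Sum.inl b) = 0 ∨ r (Sum.inl b) = 1 then (1 : ℝ) else 0))
                - ∏ b : S, (if r (Sum.inl b) = 1 then (1 : ℝ) else 0))
          + (if out = 4 then (1 : ℝ) else 0)
            * (∏ b : S, (if r (Sum.inl b) = 1 then (1 : ℝ) else 0))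
            * (∏ b : U, (if r (Sum.inr b) = 1 then (1 : ℝ) else 0)))
        * ∏ b : S ⊕ U, E b (r b))
      = ![0, 0,
          (∏ b : S, E (Sum.inl b) 1) * (1 - ∏ b : U, E (Sum.inr b) 1),
          (∏ b : U, E (Sum.inr b) 1) * (1 - ∏ b : S, E (Sum.inl b) 1),
          (∏ b : S, E (Sum.inl b) 1) * (∏ b : U, E (Sum.inr b) 1)] out := by
  intro out
  have h0 : ∀ b, ∑ k : Fin 5, (if k = 1 then (1 : ℝ) else 0) * E b k = E b 1 := by
    intro b; simp
  have h1 : ∀ b, ∑ k : Fin 5, (if k = 0 ∨ k = 1 then (1 : ℝ) else 0) * E b k = 1 := by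
    intro b
    have := hE b
    simpa [Fin.sum_univ_five] using this
  have A := sp_factor S U E (fun k => if k = 1 then (1 : ℝ) else 0)
    (fun k => if k = 1 then (1 : ℝ) else 0)
  have B := sp_factor S U E (fun k => if k = 1 then (1 : ℝ) else 0)
    (fun k => if k = 0 ∨ k = 1 then (1 : ℝ) else 0)
  have C := sp_factor S U E (fun k => if k = 0 ∨ k = 1 then (1 : ℝ) else 0)
    (fun k => if k = 1 then (1 : ℝ) else 0)
  simp only [h0, h1, Finset.prod_const_one, mul_one, one_mul] at A B C
  trans (if out = 2 then (1 : ℝ) else 0) *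
      ((∏ b : S, E (Sum.inl b) 1) - (∏ b : S, E (Sum.inl b) 1) * (∏ b : U, E (Sum.inr b) 1))
    + (if out = 3 then (1 : ℝ) else 0) *
      ((∏ b : U, E (Sum.inr b) 1) - (∏ b : S, E (Sum.inl b) 1) * (∏ b : U, E (Sum.inr b) 1))
    + (if out = 4 then (1 : ℝ) else 0) *
      ((∏ b : S, E (Sum.inl b) 1) * (∏ b : U, E (Sum.inr b) 1))
  · rw [← A, ← B, ← C, ← Finset.sum_sub_distrib, ← Finset.sum_sub_distrib, Finset.mul_sum,
      Finset.mul_sum, Finset.mul_sum, ← Finset.sum_add_distrib, ← Finset.sum_add_distrib]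
    refine Finset.sum_congr rfl fun r _ => ?_
    ring
  · clear A B C
    fin_cases out <;> simp <;> ring
end
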